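/- Let a : ℝ^d → ℝ^d be a smooth map such that a is bounded and its total derivative ∇a is bounded (as a matrix-valued function). Then there exists a constant C > 0 such that for every Schwartz function u : ℝ^d → ℂ: |∫_{ℝ^d} a(x)·∇u(x)·conj(u(x)) dx| ≤ C·‖u‖²_{H^{1/2}(ℝ^d)}, where ‖u‖²_{H^{1/2}(ℝ^d)} = ∫_{ℝ^d} (1 + ‖ξ‖²)^{1/2}·|𝓕u(ξ)|² dξ. -/

import Mathlib

open MeasureTheory FourierTransform

section helpers

open SchwartzMap LineDeriv

/-- the squared `L²` norm, on the Fourier side -/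
noncomputable def qN {d : ℕ} (w : SchwartzMap (EuclideanSpace ℝ (Fin d)) ℂ) : ℝ :=
  ∫ ξ, ‖𝓕 w ξ‖ ^ 2

/-- the squared `H¹` norm, on the Fourier side -/
noncomputable def qQ {d : ℕ} (w : SchwartzMap (EuclideanSpace ℝ (Fin d)) ℂ) : ℝ :=
  ∫ ξ, (1 + ‖ξ‖ ^ 2) * ‖𝓕 w ξ‖ ^ 2

/-- the squared `H^{1/2}` norm -/
noncomputable def qH {d : ℕ} (w : SchwartzMap (EuclideanSpace ℝ (Fin d)) ℂ) : ℝ :=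
  ∫ ξ, Real.sqrt (1 + ‖ξ‖ ^ 2) * ‖𝓕 w ξ‖ ^ 2

/-- the multiplier `e^{-arcsinh (h λ)}` -/
noncomputable def mult {d : ℕ} (h : ℝ) (ξ : EuclideanSpace ℝ (Fin d)) : ℝ :=
  Real.sqrt (1 + h ^ 2 * (1 + ‖ξ‖ ^ 2)) - h * Real.sqrt (1 + ‖ξ‖ ^ 2)

variable {d : ℕ}

lemma integrable_sq (w : SchwartzMap (EuclideanSpace ℝ (Fin d)) ℂ) :
    Integrable (fun ξ => ‖w ξ‖ ^ 2) := by
  have := (w.memLp 2).integrable_norm_pow (by norm_num)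
  simpa using this

lemma integrable_Q (w : SchwartzMap (EuclideanSpace ℝ (Fin d)) ℂ) :
    Integrable (fun ξ => (1 + ‖ξ‖ ^ 2) * ‖w ξ‖ ^ 2) := by
  have hg : (fun x : EuclideanSpace ℝ (Fin d) => (1 + ‖x‖ ^ 2) ^ ((1 : ℝ) / 2)).HasTemperateGrowth :=
    Function.hasTemperateGrowth_one_add_norm_sq_rpow _ _
  refine (integrable_sq (smulLeftCLM ℂ (fun x : EuclideanSpace ℝ (Fin d) =>
    (1 + ‖x‖ ^ 2) ^ ((1 : ℝ) / 2)) w)).congr (Filter.Eventually.of_forall fun ξ => ?_)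
  simp only [smulLeftCLM_apply_apply hg]
  rw [norm_smul, mul_pow, ← Real.sqrt_eq_rpow, Real.norm_eq_abs, sq_abs, Real.sq_sqrt (by positivity)]

lemma integrable_H (w : SchwartzMap (EuclideanSpace ℝ (Fin d)) ℂ) :
    Integrable (fun ξ => Real.sqrt (1 + ‖ξ‖ ^ 2) * ‖w ξ‖ ^ 2) := by
  refine (integrable_Q w).mono' ?_ (Filter.Eventually.of_forall fun ξ => ?_)
  · have := w.continuous
    exact Continuous.aestronglyMeasurable (by fun_prop)
  · rw [Real.norm_of_nonneg (by positivity)]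
    gcongr
    refine Real.sqrt_le_iff.2 ⟨by positivity, ?_⟩
    nlinarith [sq_nonneg ‖ξ‖, sq_nonneg (‖ξ‖ ^ 2)]

lemma mult_temperate (h : ℝ) :
    (fun ξ : EuclideanSpace ℝ (Fin d) => mult h ξ).HasTemperateGrowth := by
  have hg : (fun x : EuclideanSpace ℝ (Fin d) => (1 + ‖x‖ ^ 2) ^ ((1 : ℝ) / 2)).HasTemperateGrowth :=
    Function.hasTemperateGrowth_one_add_norm_sq_rpow _ _
  have hl : (fun x : EuclideanSpace ℝ (Fin d) => (h / Real.sqrt (1 + h ^ 2)) • x).HasTemperateGrowth :=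
    ((h / Real.sqrt (1 + h ^ 2)) • ContinuousLinearMap.id ℝ (EuclideanSpace ℝ (Fin d))).hasTemperateGrowth
  have h1 := hg.comp hl
  have hc1 := (Function.HasTemperateGrowth.const (E := EuclideanSpace ℝ (Fin d))
    (Real.sqrt (1 + h ^ 2))).mul h1
  have hc2 := (Function.HasTemperateGrowth.const (E := EuclideanSpace ℝ (Fin d)) h).mul hg
  have hfin := hc1.sub hc2
  refine (?_ : (fun ξ : EuclideanSpace ℝ (Fin d) => mult h ξ) = _) ▸ hfin
  ext ξ
  simp only [mult, Pi.sub_apply, Pi.mul_apply, Function.comp, ← Real.sqrt_eq_rpow]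
  rw [← Real.sqrt_mul (by positivity), norm_smul, mul_pow, Real.norm_eq_abs, sq_abs, div_pow,
    Real.sq_sqrt (by positivity)]
  congr 2
  have : (1 + h ^ 2) ≠ 0 := by positivity
  field_simp
  ring

lemma mult_pos {h : ℝ} (ξ : EuclideanSpace ℝ (Fin d)) : 0 < mult h ξ := by
  unfold mult
  have := Real.sqrt_lt_sqrt (x := (h * Real.sqrt (1 + ‖ξ‖ ^ 2)) ^ 2)
    (y := 1 + h ^ 2 * (1 + ‖ξ‖ ^ 2)) (by positivity)
    (by rw [mul_pow, Real.sq_sqrt (by positivity)]; linarith)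
  have h2 := Real.le_sqrt_of_sq_le (le_refl ((h * Real.sqrt (1 + ‖ξ‖ ^ 2)) ^ 2))
  linarith

lemma mult_ge {h : ℝ} (ξ : EuclideanSpace ℝ (Fin d)) :
    1 - h * Real.sqrt (1 + ‖ξ‖ ^ 2) ≤ mult h ξ := by
  unfold mult
  have : 1 ≤ Real.sqrt (1 + h ^ 2 * (1 + ‖ξ‖ ^ 2)) := by
    rw [Real.one_le_sqrt]; nlinarith [sq_nonneg (h * ‖ξ‖), sq_nonneg h]
  linarith

lemma mult_eq {h : ℝ} (ξ : EuclideanSpace ℝ (Fin d)) :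
    1 - mult h ξ ^ 2 = 2 * h * Real.sqrt (1 + ‖ξ‖ ^ 2) * mult h ξ := by
  unfold mult
  have h1 := Real.sq_sqrt (x := 1 + h ^ 2 * (1 + ‖ξ‖ ^ 2)) (by positivity)
  have h2 := Real.sq_sqrt (x := (1 + ‖ξ‖ ^ 2)) (by positivity)
  linear_combination (-1 : ℝ) * h1 +  h ^ 2 * h2

lemma mult_inv {h : ℝ} (hh : 0 < h) (ξ : EuclideanSpace ℝ (Fin d)) :
    1 ≤ mult h ξ * (1 + 2 * h * Real.sqrt (1 + ‖ξ‖ ^ 2)) := by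
  have hp := mult_pos (h := h) ξ
  have he := mult_eq (h := h) ξ
  have hg := mult_ge (h := h) ξ
  have : 0 < h * Real.sqrt (1 + ‖ξ‖ ^ 2) := by positivity
  by_cases h1 : mult h ξ ≤ 1
  · nlinarith
  · nlinarith

lemma mult_le_one {h : ℝ} (hh : 0 < h) (ξ : EuclideanSpace ℝ (Fin d)) : mult h ξ ≤ 1 := by
  have hp := mult_pos (h := h) ξ
  have he := mult_eq (h := h) ξ
  have : 0 < 2 * h * Real.sqrt (1 + ‖ξ‖ ^ 2) * mult h ξ := by positivity
  nlinarith

/-- the Fourier multiplier operator with symbol `mult h`. -/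
noncomputable def T (h : ℝ) (w : SchwartzMap (EuclideanSpace ℝ (Fin d)) ℂ) :
    SchwartzMap (EuclideanSpace ℝ (Fin d)) ℂ :=
  𝓕⁻ (smulLeftCLM ℂ (fun ξ => mult h ξ) (𝓕 w))

lemma fourier_T (h : ℝ) (w : SchwartzMap (EuclideanSpace ℝ (Fin d)) ℂ)
    (ξ : EuclideanSpace ℝ (Fin d)) : 𝓕 (T h w) ξ = (mult h ξ : ℂ) * 𝓕 w ξ := by
  unfold T
  rw [FourierTransform.fourier_fourierInv_eq, smulLeftCLM_apply_apply (mult_temperate h)]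
  simp

lemma fourier_iter (h : ℝ) (w : SchwartzMap (EuclideanSpace ℝ (Fin d)) ℂ) (k : ℕ)
    (ξ : EuclideanSpace ℝ (Fin d)) : 𝓕 ((T h)^[k] w) ξ = (mult h ξ : ℂ) ^ k * 𝓕 w ξ := by
  induction k with
  | zero => simp
  | succ k ih =>
    rw [Function.iterate_succ_apply', fourier_T, ih]; ring

lemma qN_sub_T {h : ℝ} (hh : 0 < h) (w : SchwartzMap (EuclideanSpace ℝ (Fin d)) ℂ) :
    qN (w - T h w) ≤ h ^ 2 * qQ w := by
  unfold qN qQ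
  rw [← integral_const_mul]
  refine integral_mono (integrable_sq _) ((integrable_Q _).const_mul _) fun ξ => ?_
  have e : 𝓕 (w - T h w) ξ = ((1 - mult h ξ : ℝ) : ℂ) * 𝓕 w ξ := by
    have e1 : 𝓕 (w - T h w) ξ + 𝓕 (T h w) ξ = 𝓕 w ξ := by
      rw [← add_apply, ← FourierTransform.fourier_add, sub_add_cancel]
    rw [fourier_T] at e1
    push_cast
    linear_combination e1
  simp only [e, norm_mul, mul_pow, Complex.norm_real, Real.norm_eq_abs, sq_abs]
  rw [← mul_assoc]
  gcongr
  have h2 := Real.sq_sqrt (x := (1 + ‖ξ‖ ^ 2)) (by positivity)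
  rw [← h2, ← mul_pow]
  have := mult_le_one hh ξ
  have := mult_ge (h := h) ξ
  exact pow_le_pow_left₀ (by linarith) (by linarith) 2

lemma qQ_T {h : ℝ} (hh : 0 < h) (w : SchwartzMap (EuclideanSpace ℝ (Fin d)) ℂ) :
    qQ (T h w) ≤ qQ w := by
  unfold qQ
  refine integral_mono (integrable_Q _) (integrable_Q _) fun ξ => ?_
  simp only [fourier_T, norm_mul, Complex.norm_real, Real.norm_eq_abs, abs_of_pos (mult_pos ξ)]
  have hle : mult h ξ * ‖𝓕 w ξ‖ ≤ ‖𝓕 w ξ‖ :=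
    mul_le_of_le_one_left (norm_nonneg (𝓕 w ξ)) (mult_le_one hh ξ)
  have h0 : 0 ≤ mult h ξ * ‖𝓕 w ξ‖ := mul_nonneg (mult_pos ξ).le (norm_nonneg (𝓕 w ξ))
  exact mul_le_mul_of_nonneg_left (pow_le_pow_left₀ h0 hle 2) (by positivity)

lemma qQ_nonneg (w : SchwartzMap (EuclideanSpace ℝ (Fin d)) ℂ) : 0 ≤ qQ w := by
  unfold qQ
  exact integral_nonneg fun ξ => mul_nonneg (by positivity) (by positivity)

lemma sum_qQ {h : ℝ} (hh : 0 < h) (w : SchwartzMap (EuclideanSpace ℝ (Fin d)) ℂ) (N : ℕ) :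
    h * ∑ k ∈ Finset.range N, qQ ((T h)^[k] w) ≤ qH w / 2 + h * qQ w := by
  unfold qQ qH
  rw [← integral_finsetSum _ (fun i _ => integrable_Q _), ← integral_const_mul,
    ← integral_const_mul, ← integral_div, ← integral_add ((integrable_H _).div_const _)
      ((integrable_Q _).const_mul _)]
  refine integral_mono ((integrable_finsetSum _ (fun i _ => integrable_Q _)).const_mul _)
    (((integrable_H _).div_const _).add ((integrable_Q _).const_mul _)) fun ξ => ?_
  simp only [fourier_iter, norm_mul, norm_pow, Complex.norm_real, Real.norm_eq_abs,
    abs_of_pos (mult_pos ξ)]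
  have h2 := Real.sq_sqrt (x := (1 + ‖ξ‖ ^ 2)) (by positivity)
  set L := Real.sqrt (1 + ‖ξ‖ ^ 2) with hL
  have hLp : 0 < L := by positivity
  rw [← h2]
  set m := mult h ξ with hm
  have hmp : 0 < m := mult_pos ξ
  have he : 1 - m ^ 2 = 2 * h * L * m := mult_eq ξ
  have hi : 1 ≤ m * (1 + 2 * h * L) := mult_inv hh ξ
  set S := ∑ k ∈ Finset.range N, (m ^ 2) ^ k with hS
  have hgeom : S * (1 - m ^ 2) ≤ 1 := by
    have := geom_sum_mul_neg (m ^ 2) N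
    rw [hS, this]
    have : 0 ≤ (m ^ 2) ^ N := by positivity
    linarith
  have hSn : 0 ≤ S := Finset.sum_nonneg fun i _ => by positivity
  have key : 2 * h * L * S ≤ 1 + 2 * h * L := by
    rw [he] at hgeom
    have : 2 * h * L * S ≤ (2 * h * L * S) * (m * (1 + 2 * h * L)) :=
      le_mul_of_one_le_right (by positivity) hi
    nlinarith [mul_le_mul_of_nonneg_right hgeom (show 0 ≤ 1 + 2 * h * L by positivity)]
  have e : ∑ k ∈ Finset.range N, L ^ 2 * (m ^ k * ‖𝓕 w ξ‖) ^ 2 = L ^ 2 * S * ‖𝓕 w ξ‖ ^ 2 := by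
    rw [hS, Finset.mul_sum, Finset.sum_mul]
    refine Finset.sum_congr rfl fun k _ => ?_
    ring
  rw [e]
  have : h * (L ^ 2 * S) ≤ L / 2 + h * L ^ 2 := by nlinarith
  nlinarith [mul_le_mul_of_nonneg_right this (show 0 ≤ ‖𝓕 w ξ‖ ^ 2 by positivity)]

lemma abstract_bound (C : ℝ) (hC : 0 ≤ C)
    (B : SchwartzMap (EuclideanSpace ℝ (Fin d)) ℂ → SchwartzMap (EuclideanSpace ℝ (Fin d)) ℂ → ℂ)
    (hl : ∀ f f' g, B (f - f') g = B f g - B f' g)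
    (hr : ∀ f g g', B f (g - g') = B f g - B f g')
    (h1 : ∀ f g, ∀ h : ℝ, 0 < h → ‖B f g‖ ≤ C * (qN f / h + h * qQ g))
    (h2 : ∀ f g, ∀ h : ℝ, 0 < h → ‖B f g‖ ≤ C * (h * qQ f + qN g / h))
    (u : SchwartzMap (EuclideanSpace ℝ (Fin d)) ℂ) : ‖B u u‖ ≤ 2 * C * qH u := by
  have hNQ : ∀ w : SchwartzMap (EuclideanSpace ℝ (Fin d)) ℂ, qN w ≤ qQ w := fun w => by
    unfold qN qQ
    refine integral_mono (integrable_sq _) (integrable_Q _) fun ξ => ?_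
    exact le_mul_of_one_le_left (by positivity) (by nlinarith [sq_nonneg ‖ξ‖])
  have hfix : ∀ h : ℝ, 0 < h → ‖B u u‖ ≤ 4 * C * (qH u / 2 + h * qQ u) := by
    intro h hh
    set K := qH u / 2 + h * qQ u with hK
    have step : ∀ w, ‖B w w‖ ≤ ‖B (T h w) (T h w)‖ + 4 * C * (h * qQ w) := by
      intro w
      have e : B w w = B (T h w) (T h w) + (B (w - T h w) w + B (T h w) (w - T h w)) := by
        rw [hl, hr]; ring
      have b1 := h1 (w - T h w) w h hh
      have b2 := h2 (T h w) (w - T h w) h hh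
      have a1 : qN (w - T h w) / h ≤ h * qQ w := by
        rw [div_le_iff₀ hh]; nlinarith [qN_sub_T hh w]
      have a2 := mul_le_mul_of_nonneg_left (qQ_T hh w) hh.le
      have c1 : C * (qN (w - T h w) / h + h * qQ w) ≤ C * (2 * (h * qQ w)) := by
        gcongr; linarith
      have c2 : C * (h * qQ (T h w) + qN (w - T h w) / h) ≤ C * (2 * (h * qQ w)) := by
        gcongr; linarith
      rw [e]
      have t1 := norm_add_le (B (T h w) (T h w)) (B (w - T h w) w + B (T h w) (w - T h w))
      have t2 := norm_add_le (B (w - T h w) w) (B (T h w) (w - T h w))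
      linarith
    have iter : ∀ N : ℕ, ‖B u u‖ ≤ ‖B ((T h)^[N] u) ((T h)^[N] u)‖
        + 4 * C * (h * ∑ k ∈ Finset.range N, qQ ((T h)^[k] u)) := by
      intro N
      induction N with
      | zero => simp
      | succ N ih =>
        have := step ((T h)^[N] u)
        rw [← Function.iterate_succ_apply' (T h)] at this
        rw [Finset.sum_range_succ]
        linarith
    have mono : Antitone fun k : ℕ => qQ ((T h)^[k] u) := antitone_nat_of_succ_le fun k => by
      rw [Function.iterate_succ_apply']; exact qQ_T hh _
    have hN : ∀ N : ℕ, h * (N * qQ ((T h)^[N] u)) ≤ K := by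
      intro N
      refine le_trans ?_ (sum_qQ hh u N)
      gcongr
      have := Finset.card_nsmul_le_sum (Finset.range N) (fun k => qQ ((T h)^[k] u))
        (qQ ((T h)^[N] u)) (fun k hk => mono (Finset.mem_range.1 hk).le)
      simpa using this
    have fin : ∀ N : ℕ, ‖B u u‖ ≤ 4 * C * K + (2 * C * K / h) * (1 / ((N : ℝ) + 1)) := by
      intro N
      have a := iter (N + 1)
      have b := sum_qQ hh u (N + 1)
      have c := h1 ((T h)^[N + 1] u) ((T h)^[N + 1] u) 1 one_pos
      have e := hNQ ((T h)^[N + 1] u)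
      have f := hN (N + 1)
      have g : qQ ((T h)^[N + 1] u) ≤ K / h * (1 / ((N : ℝ) + 1)) := by
        rw [div_mul_div_comm, mul_one, le_div_iff₀ (by positivity)]
        push_cast at f
        linarith
      have c' : C * (qN ((T h)^[N + 1] u) / 1 + 1 * qQ ((T h)^[N + 1] u))
          ≤ C * (2 * (K / h * (1 / ((N : ℝ) + 1)))) := by
        gcongr; linarith
      have b' := mul_le_mul_of_nonneg_left b (show 0 ≤ 4 * C by positivity)
      calc ‖B u u‖ ≤ _ := a
        _ ≤ C * (2 * (K / h * (1 / ((N : ℝ) + 1)))) + 4 * C * K := by rw [hK] at *; linarith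
        _ = _ := by ring
    have lim : Filter.Tendsto (fun N : ℕ => 4 * C * K + (2 * C * K / h) * (1 / ((N : ℝ) + 1)))
        Filter.atTop (nhds (4 * C * K + (2 * C * K / h) * 0)) :=
      (tendsto_one_div_add_atTop_nhds_zero_nat.const_mul _).const_add _
    have := ge_of_tendsto' lim fin
    simpa using this
  have lim : Filter.Tendsto (fun h : ℝ => 4 * C * (qH u / 2 + h * qQ u))
      (nhdsWithin 0 (Set.Ioi 0)) (nhds (4 * C * (qH u / 2 + 0 * qQ u))) := by
    refine Filter.Tendsto.mono_left (Continuous.tendsto (by fun_prop) 0) nhdsWithin_le_nhds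
  have := ge_of_tendsto lim (Filter.eventually_of_mem self_mem_nhdsWithin fun h hh => hfix h hh)
  linarith

lemma form_bound {c : EuclideanSpace ℝ (Fin d) → ℂ} (hc : Continuous c) {M : ℝ}
    (hM : ∀ x, ‖c x‖ ≤ M) (s t : SchwartzMap (EuclideanSpace ℝ (Fin d)) ℂ) {h : ℝ} (hh : 0 < h) :
    Integrable (fun x => c x * s x * (starRingEnd ℂ) (t x)) ∧
      ‖∫ x, c x * s x * (starRingEnd ℂ) (t x)‖ ≤ M / 2 * (qN s / h + h * qN t) := by
  have hM0 : 0 ≤ M := (norm_nonneg _).trans (hM 0)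
  have hint : Integrable (fun x => M / 2 * (‖s x‖ ^ 2 / h + h * ‖t x‖ ^ 2)) :=
    (((integrable_sq s).div_const h).add ((integrable_sq t).const_mul h)).const_mul _
  have hle : ∀ x, ‖c x * s x * (starRingEnd ℂ) (t x)‖ ≤ M / 2 * (‖s x‖ ^ 2 / h + h * ‖t x‖ ^ 2) := by
    intro x
    rw [norm_mul, norm_mul, RCLike.norm_conj]
    have : ‖s x‖ * ‖t x‖ ≤ (‖s x‖ ^ 2 / h + h * ‖t x‖ ^ 2) / 2 := by
      have e : (‖s x‖ ^ 2 / h + h * ‖t x‖ ^ 2) / 2 - ‖s x‖ * ‖t x‖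
        = (‖s x‖ - h * ‖t x‖) ^ 2 / (2 * h) := by field_simp; ring
      have : 0 ≤ (‖s x‖ - h * ‖t x‖) ^ 2 / (2 * h) := by positivity
      linarith
    calc ‖c x‖ * ‖s x‖ * ‖t x‖ = ‖c x‖ * (‖s x‖ * ‖t x‖) := by ring
      _ ≤ M * ((‖s x‖ ^ 2 / h + h * ‖t x‖ ^ 2) / 2) := by
        gcongr
        exact hM x
      _ = _ := by ring
  refine ⟨hint.mono' ?_ (Filter.Eventually.of_forall hle), ?_⟩
  · have := s.continuous
    have := t.continuous
    exact Continuous.aestronglyMeasurable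
      ((hc.mul s.continuous).mul (Complex.continuous_conj.comp t.continuous))
  · refine (norm_integral_le_of_norm_le hint (Filter.Eventually.of_forall hle)).trans_eq ?_
    rw [integral_const_mul, integral_add ((integrable_sq s).div_const h)
      ((integrable_sq t).const_mul h), integral_div, integral_const_mul]
    unfold qN
    rw [integral_norm_sq_fourier, integral_norm_sq_fourier]

lemma qN_le_qQ (w : SchwartzMap (EuclideanSpace ℝ (Fin d)) ℂ) : qN w ≤ qQ w := by
  unfold qN qQ
  refine integral_mono (integrable_sq _) (integrable_Q _) fun ξ => ?_
  exact le_mul_of_one_le_left (by positivity) (by nlinarith [sq_nonneg ‖ξ‖])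

lemma qN_deriv (f : SchwartzMap (EuclideanSpace ℝ (Fin d)) ℂ) (v : EuclideanSpace ℝ (Fin d))
    (hv : ‖v‖ ≤ 1) : qN (∂_{v} f) ≤ (2 * Real.pi) ^ 2 * qQ f := by
  unfold qN qQ
  rw [← integral_const_mul]
  refine integral_mono (integrable_sq _) ((integrable_Q _).const_mul _) fun ξ => ?_
  have hi : (fun x : EuclideanSpace ℝ (Fin d) => inner ℝ x v).HasTemperateGrowth := by fun_prop
  have e : 𝓕 (∂_{v} f) ξ = (2 * Real.pi * Complex.I) * ((inner ℝ ξ v : ℝ) * 𝓕 f ξ) := by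
    rw [fourier_lineDerivOp_eq, smul_apply, smulLeftCLM_apply_apply hi]
    simp
  simp only [e, norm_mul, Complex.norm_real, Complex.norm_I, mul_one, Complex.norm_ofNat,
    Real.norm_eq_abs, abs_of_pos Real.pi_pos]
  rw [mul_pow, mul_pow _ ‖𝓕 f ξ‖]
  gcongr
  have h1 := abs_real_inner_le_norm ξ v
  have h2 : |inner ℝ ξ v| ≤ ‖ξ‖ := h1.trans (mul_le_of_le_one_right (norm_nonneg _) hv)
  have := pow_le_pow_left₀ (abs_nonneg _) h2 2
  linarith

set_option maxHeartbeats 1000000 in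
lemma coord_bound (b : EuclideanSpace ℝ (Fin d) → ℝ) (hb : ContDiff ℝ 1 b) {M : ℝ}
    (v : EuclideanSpace ℝ (Fin d)) (hv : ‖v‖ ≤ 1)
    (hM : ∀ x, |b x| ≤ M) (hM' : ∀ x, |fderiv ℝ b x v| ≤ M)
    (u : SchwartzMap (EuclideanSpace ℝ (Fin d)) ℂ) :
    ‖∫ x, (b x : ℂ) * (∂_{v} u) x * (starRingEnd ℂ) (u x)‖
      ≤ 2 * (M * (2 * Real.pi) ^ 2) * qH u := by
  have hM0 : 0 ≤ M := (abs_nonneg _).trans (hM 0)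
  have hpi : 1 ≤ (2 * Real.pi) ^ 2 := by nlinarith [Real.pi_gt_three]
  have hbc : Continuous fun x => (b x : ℂ) := Complex.continuous_ofReal.comp hb.continuous
  have hbn : ∀ x, ‖(b x : ℂ)‖ ≤ M := fun x => by simpa using hM x
  have hb'c : Continuous fun x => ((fderiv ℝ b x v : ℝ) : ℂ) :=
    Complex.continuous_ofReal.comp ((hb.continuous_fderiv one_ne_zero).clm_apply continuous_const)
  have hb'n : ∀ x, ‖((fderiv ℝ b x v : ℝ) : ℂ)‖ ≤ M := fun x => by simpa using hM' x
  have hN0 : ∀ w : SchwartzMap (EuclideanSpace ℝ (Fin d)) ℂ, 0 ≤ qN w := fun w => by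
    unfold qN
    exact integral_nonneg fun ξ => by positivity
  refine abstract_bound (M * (2 * Real.pi) ^ 2) (by positivity)
    (fun f g => ∫ x, (b x : ℂ) * (∂_{v} f) x * (starRingEnd ℂ) (g x)) ?_ ?_ ?_ ?_ u
  · intro f f' g
    rw [← integral_sub (form_bound hbc hbn _ _ one_pos).1 (form_bound hbc hbn _ _ one_pos).1]
    congr 1
    ext x
    have : (∂_{v} (f - f')) x = (∂_{v} f) x - (∂_{v} f') x := by
      have e1 : (∂_{v} (f - f')) x + (∂_{v} f') x = (∂_{v} f) x := by
        rw [← add_apply, ← lineDerivOp_add, sub_add_cancel]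
      linear_combination e1
    rw [this]; ring
  · intro f g g'
    rw [← integral_sub (form_bound hbc hbn _ _ one_pos).1 (form_bound hbc hbn _ _ one_pos).1]
    congr 1
    ext x
    rw [sub_apply, map_sub]; ring
  · intro f g h hh
    have hgd : ∀ x, HasFDerivAt (fun y => (b y : ℂ) * (starRingEnd ℂ) (g y))
        ((b x : ℂ) • ((Complex.conjCLE : ℂ →L[ℝ] ℂ).comp (fderiv ℝ g x)) +
          ((starRingEnd ℂ) (g x)) • (Complex.ofRealCLM.comp (fderiv ℝ b x))) x := by
      intro x
      have d1 : HasFDerivAt (fun y => (b y : ℂ)) (Complex.ofRealCLM.comp (fderiv ℝ b x)) x :=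
        Complex.ofRealCLM.hasFDerivAt.comp x ((hb.differentiable one_ne_zero) x).hasFDerivAt
      have d2 : HasFDerivAt (fun y => (starRingEnd ℂ) (g y))
          ((Complex.conjCLE : ℂ →L[ℝ] ℂ).comp (fderiv ℝ g x)) x :=
        (Complex.conjCLE : ℂ →L[ℝ] ℂ).hasFDerivAt.comp x (g.differentiableAt).hasFDerivAt
      exact d1.mul d2
    have hval : ∀ x, fderiv ℝ (fun y => (b y : ℂ) * (starRingEnd ℂ) (g y)) x v =
        (b x : ℂ) * (starRingEnd ℂ) ((∂_{v} g) x)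
          + ((fderiv ℝ b x v : ℝ) : ℂ) * (starRingEnd ℂ) (g x) := by
      intro x
      rw [(hgd x).fderiv, lineDerivOp_apply_eq_fderiv]
      simp [mul_comm]
    obtain ⟨i1, n1⟩ := form_bound hbc hbn f (∂_{v} g) hh
    obtain ⟨i2, n2⟩ := form_bound hb'c hb'n f g hh
    have ibp := integral_mul_fderiv_eq_neg_fderiv_mul_of_integrable (μ := volume) (v := v)
      (f := fun y => (b y : ℂ) * (starRingEnd ℂ) (g y)) (g := f)
      (by
        simp only [hval]
        refine (i1.add i2).congr (Filter.Eventually.of_forall fun x => ?_)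
        simp only [Pi.add_apply]; ring)
      (by
        refine (form_bound hbc hbn (∂_{v} f) g hh).1.congr (Filter.Eventually.of_forall fun x => ?_)
        simp only [lineDerivOp_apply_eq_fderiv]; ring)
      (by
        refine (form_bound hbc hbn f g hh).1.congr (Filter.Eventually.of_forall fun x => ?_)
        simp only; ring)
      (fun x _ => (hgd x).differentiableAt) (fun x _ => f.differentiableAt)
    have e : ∫ x, (b x : ℂ) * (∂_{v} f) x * (starRingEnd ℂ) (g x) =
        -((∫ x, (b x : ℂ) * f x * (starRingEnd ℂ) ((∂_{v} g) x)) +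
          ∫ x, ((fderiv ℝ b x v : ℝ) : ℂ) * f x * (starRingEnd ℂ) (g x)) := by
      rw [← integral_add i1 i2]
      refine Eq.trans ?_ (ibp.trans ?_)
      · congr 1
        ext x
        simp only [lineDerivOp_apply_eq_fderiv]; ring
      · congr 2
        ext x
        rw [hval]; ring
    simp only [e, norm_neg]
    refine (norm_add_le _ _).trans ((add_le_add n1 n2).trans ?_)
    have q1 := qN_deriv g v hv
    have q2 := qN_le_qQ g
    have q3 := qQ_nonneg g
    have q4 : 0 ≤ qN f / h := div_nonneg (hN0 f) hh.le
    have key : qN f / h + h * ((qN (∂_{v} g) + qN g) / 2)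
        ≤ (2 * Real.pi) ^ 2 * (qN f / h + h * qQ g) := by
      have k1 : qN f / h ≤ (2 * Real.pi) ^ 2 * (qN f / h) := le_mul_of_one_le_left q4 hpi
      have k2 : (qN (∂_{v} g) + qN g) / 2 ≤ (2 * Real.pi) ^ 2 * qQ g := by
        have : qQ g ≤ (2 * Real.pi) ^ 2 * qQ g := le_mul_of_one_le_left q3 hpi
        linarith
      have k3 := mul_le_mul_of_nonneg_left k2 hh.le
      linarith
    have := mul_le_mul_of_nonneg_left key hM0
    linarith
  · intro f g h hh
    have n1 := (form_bound hbc hbn (∂_{v} f) g (inv_pos.2 hh)).2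
    refine n1.trans ?_
    have q1 := mul_le_mul_of_nonneg_left (qN_deriv f v hv) hh.le
    have q4 : 0 ≤ qN g / h := div_nonneg (hN0 g) hh.le
    have q3 := hN0 (∂_{v} f)
    have key : (qN (∂_{v} f) / h⁻¹ + h⁻¹ * qN g) / 2
        ≤ (2 * Real.pi) ^ 2 * (h * qQ f + qN g / h) := by
      have k1 : qN g / h ≤ (2 * Real.pi) ^ 2 * (qN g / h) := le_mul_of_one_le_left q4 hpi
      rw [div_inv_eq_mul, inv_mul_eq_div]
      have : 0 ≤ h * qN (∂_{v} f) := by positivity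
      linarith
    have := mul_le_mul_of_nonneg_left key hM0
    linarith

end helpers



/-- If `a : ℝ^d → ℝ^d` is smooth, bounded, with bounded derivative, then
`|∫ a(x)·∇u(x) conj(u(x)) dx| ≤ C ‖u‖²_{H^{1/2}}` for every Schwartz function `u`. -/
theorem stmt_5 (d : ℕ) (hd : 1 ≤ d)
    (a : EuclideanSpace ℝ (Fin d) → EuclideanSpace ℝ (Fin d))
    (ha : ContDiff ℝ (⊤ : ℕ∞) a)
    (ha_bdd : ∃ M : ℝ, ∀ x, ‖a x‖ ≤ M)
    (ha'_bdd : ∃ M : ℝ, ∀ x, ‖fderiv ℝ a x‖ ≤ M) :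
    ∃ C : ℝ, 0 < C ∧
      ∀ u : SchwartzMap (EuclideanSpace ℝ (Fin d)) ℂ,
        ‖∫ x : EuclideanSpace ℝ (Fin d),
            (∑ i, ((a x i : ℝ) : ℂ) * fderiv ℝ (⇑u) x (EuclideanSpace.single i 1)) *
              (starRingEnd ℂ) (u x)‖ ≤
          C * ∫ ξ : EuclideanSpace ℝ (Fin d),
            (1 + ‖ξ‖ ^ 2) ^ ((1 : ℝ) / 2) * ‖𝓕 (⇑u) ξ‖ ^ 2 := by
  obtain ⟨M₁, h₁⟩ := ha_bdd
  obtain ⟨M₂, h₂⟩ := ha'_bdd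
  set M := max M₁ M₂ with hMdef
  have hM0 : 0 ≤ M := ((norm_nonneg _).trans (h₁ 0)).trans (le_max_left _ _)
  refine ⟨d * (2 * (M * (2 * Real.pi) ^ 2)) + 1, by positivity, fun u => ?_⟩
  have hcoord : ∀ i : Fin d, ContDiff ℝ 1 fun x => a x i := fun i =>
    ((EuclideanSpace.proj (𝕜 := ℝ) i).contDiff.comp ha).of_le (by exact_mod_cast le_top)
  have hbd : ∀ (i : Fin d) x, |a x i| ≤ M := fun i x =>
    ((PiLp.norm_apply_le (a x) i).trans (h₁ x)).trans (le_max_left _ _)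
  have hsingle : ∀ i : Fin d, ‖(EuclideanSpace.single i (1 : ℝ))‖ ≤ 1 := fun i => by simp
  have hbd' : ∀ (i : Fin d) x, |fderiv ℝ (fun y => a y i) x (EuclideanSpace.single i 1)| ≤ M := by
    intro i x
    have hd : HasFDerivAt (fun y => a y i)
        ((EuclideanSpace.proj (𝕜 := ℝ) i).comp (fderiv ℝ a x)) x :=
      (EuclideanSpace.proj (𝕜 := ℝ) i).hasFDerivAt.comp x
        ((ha.differentiable (by simp)) x).hasFDerivAt
    rw [hd.fderiv]
    have e1 := PiLp.norm_apply_le (fderiv ℝ a x (EuclideanSpace.single i 1)) i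
    have e2 := (fderiv ℝ a x).le_of_opNorm_le_of_le (h₂ x) (hsingle i)
    rw [mul_one] at e2
    exact (e1.trans e2).trans (le_max_right _ _)
  have hH : ∫ ξ : EuclideanSpace ℝ (Fin d), (1 + ‖ξ‖ ^ 2) ^ ((1 : ℝ) / 2) * ‖𝓕 (⇑u) ξ‖ ^ 2
      = qH u := by
    unfold qH
    simp only [Real.sqrt_eq_rpow]
    rfl
  have hH0 : 0 ≤ qH u := by
    unfold qH
    exact integral_nonneg fun ξ => mul_nonneg (by positivity) (by positivity)
  rw [hH]
  have hc : ∀ i : Fin d, Continuous fun x => ((a x i : ℝ) : ℂ) := fun i =>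
    Complex.continuous_ofReal.comp (hcoord i).continuous
  have hint : ∀ i : Fin d, Integrable fun x =>
      ((a x i : ℝ) : ℂ) * fderiv ℝ (⇑u) x (EuclideanSpace.single i 1) * (starRingEnd ℂ) (u x) :=
    fun i => (form_bound (hc i) (fun x => by simpa using hbd i x)
      (LineDeriv.lineDerivOp (EuclideanSpace.single i (1 : ℝ)) u) u one_pos).1
  simp only [Finset.sum_mul]
  rw [integral_finsetSum _ fun i _ => hint i]
  refine (norm_sum_le _ _).trans ?_
  refine (Finset.sum_le_card_nsmul _ _ (2 * (M * (2 * Real.pi) ^ 2) * qH u) fun i _ =>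
    coord_bound (fun x => a x i) (hcoord i) _ (hsingle i) (hbd i) (hbd' i) u).trans ?_
  simp only [Finset.card_univ, Fintype.card_fin, nsmul_eq_mul]
  linarith
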